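/- arXiv:1810.10660 — 5 statements merged into one kernel-verified Lean document; each statement's English description precedes it below -/
import Mathlib

section
/- (Proposition 1.) Fix β ≥ 0. The function S ↦ V(β,S) on [0, ∞) attains its maximum at a unique strictly positive value of S if and only if c_S + η_S < a(β)·(δr + β)/log Σ. If this strict inequality holds, the unique maximizer S* > 0 is the unique solution of the first-order condition a(β)·(δr + β)/((log Σ)·R(β,S)·(S+1)) = c_S + η_S. If the inequality is violated, then S = 0 maximizes V(β, ·) over [0, ∞). -/
/-- Cache hit probability `h(S) = log(S+1)/log Σ`. -/
noncomputable def hitProb (Sig S : ℝ) : ℝ := Real.log (S + 1) / Real.log Sig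

/-- Average network capacity `R(β,S) = (δr + β)·h(S) + 1`. -/
noncomputable def capR (Sig dr β S : ℝ) : ℝ := (dr + β) * hitProb Sig S + 1

/-- Coefficient `a(β) = ((ε−1)^(ε−1)/ε^ε)·A/(c + η_β·β)^(ε−1)`. -/
noncomputable def coefA (A ε c ηβ β : ℝ) : ℝ :=
  (ε - 1) ^ (ε - 1) / ε ^ ε * A / (c + ηβ * β) ^ (ε - 1)

/-- Operational profit `V(β,S) = a(β)·log R(β,S) − (c_S + η_S)·S − f`. -/
noncomputable def profitV (Sig dr A ε c ηβ cS ηS f β S : ℝ) : ℝ :=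
  coefA A ε c ηβ β * Real.log (capR Sig dr β S) - (cS + ηS) * S - f

/-- Marginal revenue `a·(δr + β)/((log Σ)·R(β,S)·(S+1))` of cache capacity. -/
noncomputable def marginalRevenue (Sig dr β a S : ℝ) : ℝ :=
  a * (dr + β) / (Real.log Sig * capR Sig dr β S * (S + 1))

section

variable {Sig dr β a : ℝ}

theorem coefA_pos {A ε c ηβ : ℝ} (hA : 0 < A) (hε : 1 < ε) (hc : 0 < c) (hηβ : 0 < ηβ)
    (hβ : 0 ≤ β) : 0 < coefA A ε c ηβ β := by
  have h1 : 0 < (ε - 1) ^ (ε - 1) := Real.rpow_pos_of_pos (by linarith) _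
  have h2 : 0 < ε ^ ε := Real.rpow_pos_of_pos (by linarith) _
  have h3 : 0 < (c + ηβ * β) ^ (ε - 1) := Real.rpow_pos_of_pos (by positivity) _
  unfold coefA
  positivity

theorem capR_zero : capR Sig dr β 0 = 1 := by simp [capR, hitProb]

theorem capR_monotoneOn (hSig : 1 < Sig) (hd : 0 < dr + β) :
    MonotoneOn (capR Sig dr β) (Set.Ici 0) := by
  intro x hx y hy hxy
  have hL := Real.log_pos hSig
  have hx' : (0 : ℝ) ≤ x := hx
  unfold capR hitProb
  gcongr

theorem one_le_capR (hSig : 1 < Sig) (hd : 0 < dr + β) {S : ℝ} (hS : 0 ≤ S) :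
    1 ≤ capR Sig dr β S :=
  capR_zero.symm.le.trans (capR_monotoneOn hSig hd Set.self_mem_Ici hS hS)

theorem hasDerivAt_capR {S : ℝ} (hS : 0 ≤ S) :
    HasDerivAt (capR Sig dr β) ((dr + β) * ((S + 1)⁻¹ / Real.log Sig)) S := by
  have h := ((((hasDerivAt_id S).add_const 1).log (by simp; linarith)).div_const
    (Real.log Sig)).const_mul (dr + β) |>.add_const 1
  unfold capR hitProb
  simpa using h

theorem hasDerivAt_profitV {A ε c ηβ cS ηS f S : ℝ} (hSig : 1 < Sig) (hd : 0 < dr + β)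
    (hS : 0 ≤ S) :
    HasDerivAt (profitV Sig dr A ε c ηβ cS ηS f β)
      (marginalRevenue Sig dr β (coefA A ε c ηβ β) S - (cS + ηS)) S := by
  have hL := Real.log_pos hSig
  have hR := one_le_capR hSig hd hS
  have h := ((((hasDerivAt_capR hS).log (by linarith)).const_mul (coefA A ε c ηβ β)).sub
    ((hasDerivAt_id S).const_mul (cS + ηS))).sub_const f
  refine h.congr_deriv ?_
  unfold marginalRevenue
  field_simp

theorem marginalRevenue_zero : marginalRevenue Sig dr β a 0 = a * (dr + β) / Real.log Sig := by
  simp [marginalRevenue, capR_zero]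

theorem marginalRevenue_strictAntiOn (hSig : 1 < Sig) (hd : 0 < dr + β) (ha : 0 < a) :
    StrictAntiOn (marginalRevenue Sig dr β a) (Set.Ici 0) := by
  intro x hx y hy hxy
  have hL := Real.log_pos hSig
  have hx' : (0 : ℝ) ≤ x := hx
  have hRx := one_le_capR hSig hd hx
  have hRxy := capR_monotoneOn hSig hd hx hy hxy.le
  unfold marginalRevenue
  have hpos : 0 < capR Sig dr β x := by linarith
  have hpos' : 0 < capR Sig dr β y := by linarith
  apply div_lt_div_of_pos_left (by positivity) (by positivity)
  exact mul_lt_mul' (by gcongr) (by linarith) (by linarith) (by positivity)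

theorem marginalRevenue_continuousOn (hSig : 1 < Sig) (hd : 0 < dr + β) :
    ContinuousOn (marginalRevenue Sig dr β a) (Set.Ici 0) := by
  have hL := Real.log_pos hSig
  have hR : ContinuousOn (capR Sig dr β) (Set.Ici 0) := fun S hS =>
    (hasDerivAt_capR hS).continuousAt.continuousWithinAt
  refine continuousOn_const.div ((continuousOn_const.mul hR).mul (by fun_prop)) fun S hS => ?_
  have hS' : (0 : ℝ) ≤ S := hS
  have hpos : 0 < capR Sig dr β S := by linarith [one_le_capR hSig hd hS]
  positivity

theorem exists_marginalRevenue_eq {k : ℝ} (hSig : 1 < Sig) (hd : 0 < dr + β) (ha : 0 < a)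
    (hk : 0 < k) (hlt : k < a * (dr + β) / Real.log Sig) :
    ∃ S, 0 < S ∧ marginalRevenue Sig dr β a S = k := by
  have hL := Real.log_pos hSig
  set M := a * (dr + β) / (Real.log Sig * k) with hM
  have hM0 : 0 ≤ M := by positivity
  have hR := one_le_capR hSig hd hM0
  have hpos : 0 < capR Sig dr β M := by linarith
  have hMk : marginalRevenue Sig dr β a M ≤ k := by
    unfold marginalRevenue
    rw [div_le_iff₀ (by positivity)]
    have h1 : a * (dr + β) = k * (Real.log Sig * 1 * M) := by
      rw [hM]; field_simp
    rw [h1]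
    gcongr
    linarith
  obtain ⟨S, hS, hSk⟩ := intermediate_value_Icc' hM0
    ((marginalRevenue_continuousOn (a := a) hSig hd).mono Set.Icc_subset_Ici_self)
    ⟨hMk, by rw [marginalRevenue_zero]; exact hlt.le⟩
  refine ⟨S, lt_of_le_of_ne hS.1 ?_, hSk⟩
  rintro rfl
  rw [marginalRevenue_zero] at hSk
  exact hlt.ne' hSk

/-- The profit lies strictly below each of its tangent lines away from the point of tangency. -/
theorem profitV_sub_lt {A ε c ηβ cS ηS f x S : ℝ} (hSig : 1 < Sig) (hd : 0 < dr + β)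
    (ha : 0 < coefA A ε c ηβ β) (hx : 0 ≤ x) (hS : 0 ≤ S) (hne : S ≠ x) :
    profitV Sig dr A ε c ηβ cS ηS f β S - profitV Sig dr A ε c ηβ cS ηS f β x <
      (marginalRevenue Sig dr β (coefA A ε c ηβ β) x - (cS + ηS)) * (S - x) := by
  have hderiv : ∀ y, 0 ≤ y → HasDerivAt (profitV Sig dr A ε c ηβ cS ηS f β)
      (marginalRevenue Sig dr β (coefA A ε c ηβ β) y - (cS + ηS)) y :=
    fun y hy => hasDerivAt_profitV hSig hd hy
  have hanti := marginalRevenue_strictAntiOn hSig hd ha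
  rcases lt_or_gt_of_ne hne with h | h
  · obtain ⟨y, hy, hyeq⟩ := exists_hasDerivAt_eq_slope _ _ h
      (fun z hz => (hderiv z (hS.trans hz.1)).continuousAt.continuousWithinAt)
      (fun z hz => hderiv z (hS.trans hz.1.le))
    have hlt := hanti (hS.trans hy.1.le) hx hy.2
    rw [eq_div_iff (by linarith)] at hyeq
    nlinarith
  · obtain ⟨y, hy, hyeq⟩ := exists_hasDerivAt_eq_slope _ _ h
      (fun z hz => (hderiv z (hx.trans hz.1)).continuousAt.continuousWithinAt)
      (fun z hz => hderiv z (hx.trans hz.1.le))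
    have hlt := hanti hx (hx.trans hy.1.le) hy.1
    rw [eq_div_iff (by linarith)] at hyeq
    nlinarith

end

/-- Proposition 1: Fix β ≥ 0.  The function `S ↦ V(β,S)` on `[0,∞)`
attains its maximum at a unique strictly positive value of `S` if and only if
`c_S + η_S < a(β)·(δr + β)/log Σ`.  If this strict inequality holds, the unique
maximizer `S* > 0` is the unique positive solution of the first-order condition
`a(β)·(δr+β)/((log Σ)·R(β,S)·(S+1)) = c_S + η_S`.  If the inequality is violated,
then `S = 0` maximizes `V(β,·)` over `[0,∞)`. -/
theorem cache_optimum (Sig dr A ε c ηβ cS ηS f : ℝ)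
    (hSig : 1 < Sig) (hdr : 0 < dr) (hA : 0 < A) (hε : 1 < ε) (hc : 0 < c)
    (hηβ : 0 < ηβ) (hcS : 0 ≤ cS) (hηS : 0 ≤ ηS) (hcη : 0 < cS + ηS)
    (β : ℝ) (hβ : 0 ≤ β) :
    ((∃ Sstar, 0 < Sstar ∧
        IsMaxOn (fun S => profitV Sig dr A ε c ηβ cS ηS f β S) (Set.Ici 0) Sstar ∧
        ∀ S ∈ Set.Ici (0 : ℝ),
          IsMaxOn (fun S => profitV Sig dr A ε c ηβ cS ηS f β S) (Set.Ici 0) S →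
            S = Sstar)
      ↔ cS + ηS < coefA A ε c ηβ β * (dr + β) / Real.log Sig) ∧
    (cS + ηS < coefA A ε c ηβ β * (dr + β) / Real.log Sig →
      ∃ Sstar, 0 < Sstar ∧
        coefA A ε c ηβ β * (dr + β) /
            (Real.log Sig * capR Sig dr β Sstar * (Sstar + 1)) = cS + ηS ∧
        (∀ S, 0 < S →
          coefA A ε c ηβ β * (dr + β) /
              (Real.log Sig * capR Sig dr β S * (S + 1)) = cS + ηS → S = Sstar) ∧
        IsMaxOn (fun S => profitV Sig dr A ε c ηβ cS ηS f β S) (Set.Ici 0) Sstar) ∧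
    (¬ (cS + ηS < coefA A ε c ηβ β * (dr + β) / Real.log Sig) →
      IsMaxOn (fun S => profitV Sig dr A ε c ηβ cS ηS f β S) (Set.Ici 0) 0) := by
  have hd : 0 < dr + β := by linarith
  have ha : 0 < coefA A ε c ηβ β := coefA_pos hA hε hc hηβ hβ
  have interior_max : ∀ x, 0 < x →
      marginalRevenue Sig dr β (coefA A ε c ηβ β) x = cS + ηS → ∀ S, 0 ≤ S → S ≠ x →
      profitV Sig dr A ε c ηβ cS ηS f β S < profitV Sig dr A ε c ηβ cS ηS f β x := by
    intro x hx hfoc S hS hne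
    have h := profitV_sub_lt (cS := cS) (ηS := ηS) (f := f) hSig hd ha hx.le hS hne
    rw [hfoc, sub_self, zero_mul] at h
    linarith
  have zero_max : ¬ (cS + ηS < coefA A ε c ηβ β * (dr + β) / Real.log Sig) →
      IsMaxOn (fun S => profitV Sig dr A ε c ηβ cS ηS f β S) (Set.Ici 0) 0 := by
    intro hle S hS
    have hS' : (0 : ℝ) ≤ S := hS
    rcases eq_or_ne S 0 with rfl | hne
    · exact le_refl (profitV Sig dr A ε c ηβ cS ηS f β _)
    have h := profitV_sub_lt (cS := cS) (ηS := ηS) (f := f) hSig hd ha le_rfl hS' hne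
    rw [marginalRevenue_zero] at h
    show profitV Sig dr A ε c ηβ cS ηS f β S ≤ profitV Sig dr A ε c ηβ cS ηS f β 0
    nlinarith
  have isMaxOn_of_foc : ∀ x, 0 < x →
      marginalRevenue Sig dr β (coefA A ε c ηβ β) x = cS + ηS →
      IsMaxOn (fun S => profitV Sig dr A ε c ηβ cS ηS f β S) (Set.Ici 0) x := by
    intro x hx hfoc S hS
    rcases eq_or_ne S x with rfl | hne
    · exact le_refl (profitV Sig dr A ε c ηβ cS ηS f β _)
    · exact (interior_max x hx hfoc S hS hne).le
  refine ⟨⟨?_, fun hlt => ?_⟩, fun hlt => ?_, zero_max⟩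
  · rintro ⟨x, hx, -, huniq⟩
    by_contra hle
    exact hx.ne (huniq 0 Set.self_mem_Ici (zero_max hle))
  · obtain ⟨x, hx, hfoc⟩ := exists_marginalRevenue_eq hSig hd ha hcη hlt
    refine ⟨x, hx, isMaxOn_of_foc x hx hfoc, fun S hS hmax => ?_⟩
    by_contra hne
    exact (interior_max x hx hfoc S hS hne).not_ge (hmax hx.le)
  · obtain ⟨x, hx, hfoc⟩ := exists_marginalRevenue_eq hSig hd ha hcη hlt
    exact ⟨x, hx, hfoc, fun S hS h => (marginalRevenue_strictAntiOn hSig hd ha).injOn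
      hS.le hx.le (h.trans hfoc.symm), isMaxOn_of_foc x hx hfoc⟩
end

section
/- (Proposition 3.) Let K ≥ 2 and let v_1 ≤ v_2 ≤ … ≤ v_K be real numbers and F ∈ ℝ. The following are equivalent: (i) for all subsets Θ, Ψ with ∅ ≠ Θ ⊊ Ψ ⊆ {1,…,K}, PC(Ψ⁺) ≥ PC(Θ⁺); (ii) v_1 ≥ (1/(K+1))·(Σ_{k=1}^{K} v_k − F). -/
/-- A sum over `B` is at least the sum over a subset `A` plus `c` for every further element. -/
lemma sum_add_card_sub_mul_le {ι : Type*} [DecidableEq ι] {A B : Finset ι} (h : A ⊆ B)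
    {v : ι → ℝ} {c : ℝ} (hc : ∀ i ∈ B, c ≤ v i) :
    ∑ i ∈ A, v i + ((B.card : ℝ) - A.card) * c ≤ ∑ i ∈ B, v i := by
  have hcard : ((B \ A).card : ℝ) = B.card - A.card := by
    rw [Finset.card_sdiff_of_subset h, Nat.cast_sub (Finset.card_le_card h)]
  have hle := Finset.card_nsmul_le_sum (B \ A) v c
    fun i hi => hc i (Finset.mem_sdiff.1 hi).1
  rw [nsmul_eq_mul, hcard] at hle
  linarith [Finset.sum_sdiff (f := v) h]


/-- Proposition 3: Let `K ≥ 2`, `v_1 ≤ … ≤ v_K` real, `F ∈ ℝ`, and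
`PC(Θ⁺) = (Σ_{k∈Θ} v_k − F)/(|Θ| + 1)` for `Θ ⊆ {1,…,K}`.  Then
`PC(Ψ⁺) ≥ PC(Θ⁺)` for all `∅ ≠ Θ ⊊ Ψ ⊆ {1,…,K}` if and only if
`v_1 ≥ (1/(K+1))·(Σ_{k=1}^{K} v_k − F)`. -/
theorem grand_coalition_condition (K : ℕ) (hK : 2 ≤ K) (v : ℕ → ℝ)
    (hmono : ∀ i j, 1 ≤ i → i ≤ j → j ≤ K → v i ≤ v j) (F : ℝ) :
    (∀ Θ Ψ : Finset ℕ, Θ.Nonempty → Θ ⊂ Ψ → Ψ ⊆ Finset.Icc 1 K →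
        (∑ k ∈ Θ, v k - F) / (Θ.card + 1) ≤ (∑ k ∈ Ψ, v k - F) / (Ψ.card + 1)) ↔
      (1 / ((K : ℝ) + 1)) * (∑ k ∈ Finset.Icc 1 K, v k - F) ≤ v 1 := by
  have hK0 : (0 : ℝ) < K + 1 := by positivity
  rw [one_div_mul_eq_div, div_le_iff₀ hK0]
  constructor
  · intro h
    have h1 : 1 ∈ Finset.Icc 1 K := by simp; omega
    have hne : ((Finset.Icc 1 K).erase 1).Nonempty := ⟨2, by simp; omega⟩
    have hPC := h _ _ hne (Finset.erase_ssubset h1) subset_rfl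
    have hcard : (((Finset.Icc 1 K).erase 1).card : ℝ) + 1 = K := by
      exact_mod_cast (by simpa using Finset.card_erase_add_one h1)
    have hsum := Finset.add_sum_erase _ v h1
    have hKpos : (0 : ℝ) < K := by exact_mod_cast (by omega : 0 < K)
    rw [hcard, Nat.card_Icc, Nat.add_sub_cancel, div_le_div_iff₀ hKpos hK0] at hPC
    rw [← hsum] at hPC ⊢
    linarith
  · intro h Θ Ψ _ hΘΨ hΨ
    have hv : ∀ k ∈ Finset.Icc 1 K, v 1 ≤ v k := fun k hk =>
      hmono 1 k le_rfl (Finset.mem_Icc.1 hk).1 (Finset.mem_Icc.1 hk).2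
    have hΘK := sum_add_card_sub_mul_le (hΘΨ.subset.trans hΨ) hv
    have hΘΨs := sum_add_card_sub_mul_le hΘΨ.subset fun k hk => hv k (hΨ hk)
    rw [Nat.card_Icc, Nat.add_sub_cancel] at hΘK
    have hcard : (Θ.card : ℝ) ≤ Ψ.card := by exact_mod_cast Finset.card_le_card hΘΨ.subset
    have hΘ : ∑ k ∈ Θ, v k - F ≤ (Θ.card + 1) * v 1 := by linarith
    rw [div_le_div_iff₀ (by positivity) (by positivity)]
    have hgain := mul_le_mul_of_nonneg_right hΘ (sub_nonneg.2 hcard)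
    have hΘ0 : (0 : ℝ) ≤ Θ.card + 1 := by positivity
    have hscale := mul_le_mul_of_nonneg_right hΘΨs hΘ0
    linarith
end

section
/- Suppose min_{1≤k≤K} v_k ≥ (1/(K+1))·(Σ_{k=1}^{K} v_k − F) and Σ_{k=1}^{K} v_k ≥ F ≥ 0. Then the egalitarian payoff vector, which assigns w = (Σ_{k=1}^{K} v_k − F)/(K+1) to every player i ∈ {1,…,K+1}, lies in the core of the game: Σ_{i∈C} w ≥ v(C) for every coalition C ⊆ {1,…,K+1}, and Σ_{i=1}^{K+1} w = v({1,…,K+1}). -/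
/-- Characteristic function of the game: players are `1,…,K+1` with the ISP
indexed `K+1`.  `charv K vk F C = (Σ_{k ∈ C, k ≤ K} vk k) − F` if `K+1 ∈ C` and
`C` contains at least one CP index `k ≤ K`, and `charv K vk F C = 0` otherwise. -/
noncomputable def charv (K : ℕ) (vk : ℕ → ℝ) (F : ℝ) (C : Finset ℕ) : ℝ :=
  if (K + 1) ∈ C ∧ ∃ k ∈ C, k ≤ K then
    (∑ k ∈ C.filter (fun k => k ≤ K), vk k) - F
  else 0

/-- Suppose `min_{1≤k≤K} v_k ≥ (1/(K+1))·(Σ_{k=1}^{K} v_k − F)` and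
`Σ_{k=1}^{K} v_k ≥ F ≥ 0`.  Then the egalitarian payoff vector, assigning
`w = (Σ_{k=1}^{K} v_k − F)/(K+1)` to every player, lies in the core:
`Σ_{i∈C} w ≥ v(C)` for every coalition `C ⊆ {1,…,K+1}`, and
`Σ_{i=1}^{K+1} w = v({1,…,K+1})`. -/
theorem egalitarian_in_core (K : ℕ) (hK : 1 ≤ K) (vk : ℕ → ℝ)
    (hv : ∀ k ∈ Finset.Icc 1 K, 0 < vk k) (F : ℝ)
    (hmin : (Finset.Icc 1 K).inf' (Finset.nonempty_Icc.mpr hK) vk ≥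
      (1 / ((K : ℝ) + 1)) * (∑ k ∈ Finset.Icc 1 K, vk k - F))
    (hF0 : 0 ≤ F) (hFsum : F ≤ ∑ k ∈ Finset.Icc 1 K, vk k) :
    let w : ℝ := (∑ k ∈ Finset.Icc 1 K, vk k - F) / ((K : ℝ) + 1)
    (∀ C : Finset ℕ, C ⊆ Finset.Icc 1 (K + 1) →
        charv K vk F C ≤ ∑ _i ∈ C, w) ∧
    (∑ _i ∈ Finset.Icc 1 (K + 1), w) = charv K vk F (Finset.Icc 1 (K + 1)) := by
  intro w
  have hK1 : (0 : ℝ) < (K : ℝ) + 1 := by positivity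
  have hw0 : 0 ≤ w := div_nonneg (sub_nonneg.mpr hFsum) hK1.le
  have hwS : ((K : ℝ) + 1) * w = ∑ k ∈ Finset.Icc 1 K, vk k - F :=
    mul_div_cancel₀ _ hK1.ne'
  have hwv : ∀ k ∈ Finset.Icc 1 K, w ≤ vk k := by
    intro k hk
    have hle := hmin.le.trans (Finset.inf'_le vk hk)
    rwa [one_div_mul_eq_div] at hle
  refine ⟨fun C hC => ?_, ?_⟩
  · unfold charv
    split_ifs with h
    · set D := C.filter (fun k => k ≤ K) with hD
      have hCD : C = insert (K + 1) D := by
        ext k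
        have hk := @hC k
        simp only [hD, Finset.mem_insert, Finset.mem_filter, Finset.mem_Icc] at hk ⊢
        constructor
        · intro hkC
          have := hk hkC
          by_cases hkK : k ≤ K
          · exact Or.inr ⟨hkC, hkK⟩
          · exact Or.inl (by omega)
        · rintro (rfl | hkC)
          · exact h.1
          · exact hkC.1
      have hDI : D ⊆ Finset.Icc 1 K := by
        intro k hk
        obtain ⟨hkC, hkK⟩ := Finset.mem_filter.mp hk
        exact Finset.mem_Icc.mpr ⟨(Finset.mem_Icc.mp (hC hkC)).1, hkK⟩
      have hnot : K + 1 ∉ D := by simp [hD]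
      have hexcess : ∑ k ∈ D, (vk k - w) ≤ ∑ k ∈ Finset.Icc 1 K, (vk k - w) :=
        Finset.sum_le_sum_of_subset_of_nonneg hDI
          fun k hk _ => sub_nonneg.mpr (hwv k hk)
      have hsum : ∑ _i ∈ C, w = w + ∑ _i ∈ D, w := by
        conv_lhs => rw [hCD]
        exact Finset.sum_insert hnot
      have hconst : ∑ _i ∈ Finset.Icc 1 K, w = (K : ℝ) * w := by simp
      rw [Finset.sum_sub_distrib, Finset.sum_sub_distrib, hconst] at hexcess
      rw [hsum]
      linarith
    · exact Finset.sum_nonneg fun _ _ => hw0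
  · have hfilter : (Finset.Icc 1 (K + 1)).filter (fun k => k ≤ K) = Finset.Icc 1 K := by
      ext k
      simp only [Finset.mem_filter, Finset.mem_Icc]
      omega
    have hmem : K + 1 ∈ Finset.Icc 1 (K + 1) ∧ ∃ k ∈ Finset.Icc 1 (K + 1), k ≤ K :=
      ⟨by simp, 1, by simp, hK⟩
    rw [charv, if_pos hmem, hfilter, ← hwS]
    simp
end

section
/- (Proposition 4.) Let v_1,…,v_K be real numbers and F ∈ ℝ. If min_{1≤k≤K} v_k ≥ (1/(K+1))·(Σ_{k=1}^{K} v_k − F), then for every nonempty subset K' ⊆ {1,…,K}, min_{k∈K'} v_k ≥ (1/(|K'|+1))·(Σ_{k∈K'} v_k − F); i.e., the Coalition Admission Control condition continues to hold for the remaining members irrespective of the number and identities of CPs that drop out of the coalition. -/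
/-- If `m` is a lower bound of `v` on `s`, a bound on the total over `s` by `(#s + 1) * m` passes
to every subset, since each dropped term is at least `m`. -/
theorem sum_sub_le_card_add_one_mul_of_subset {ι : Type*} {s t : Finset ι} (hts : t ⊆ s)
    {v : ι → ℝ} {F m : ℝ} (hm : ∀ k ∈ s, m ≤ v k)
    (h : ∑ k ∈ s, v k - F ≤ ((s.card : ℝ) + 1) * m) :
    ∑ k ∈ t, v k - F ≤ ((t.card : ℝ) + 1) * m := by
  classical
  have hdrop : ((s \ t).card : ℝ) * m ≤ ∑ k ∈ s \ t, v k := by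
    simpa using Finset.card_nsmul_le_sum (s \ t) v m fun k hk => hm k (Finset.mem_sdiff.mp hk).1
  have hcard : ((s \ t).card : ℝ) + t.card = s.card := by
    exact_mod_cast Finset.card_sdiff_add_card_eq_card hts
  have hsum := Finset.sum_sdiff (f := v) hts
  rw [← hcard] at h
  linarith

/-- Proposition 4: If
`min_{1≤k≤K} v_k ≥ (1/(K+1))·(Σ_{k=1}^{K} v_k − F)`, then for every nonempty
`K' ⊆ {1,…,K}` we have `min_{k∈K'} v_k ≥ (1/(|K'|+1))·(Σ_{k∈K'} v_k − F)`:
the Coalition Admission Control condition continues to hold for the remaining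
members irrespective of the number and identities of CPs that drop out. -/
theorem admission_control_sustained (K : ℕ) (hK : 1 ≤ K) (v : ℕ → ℝ) (F : ℝ)
    (h : (Finset.Icc 1 K).inf' (Finset.nonempty_Icc.mpr hK) v ≥
      (1 / ((K : ℝ) + 1)) * (∑ k ∈ Finset.Icc 1 K, v k - F)) :
    ∀ (Θ : Finset ℕ), Θ ⊆ Finset.Icc 1 K → ∀ (hne : Θ.Nonempty),
      Θ.inf' hne v ≥ (1 / ((Θ.card : ℝ) + 1)) * (∑ k ∈ Θ, v k - F) := by
  intro Θ hΘ hne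
  rw [ge_iff_le, one_div, inv_mul_le_iff₀ (by positivity)] at h ⊢
  refine (sum_sub_le_card_add_one_mul_of_subset hΘ (fun k hk => Finset.inf'_le v hk)
    (by simpa using h)).trans ?_
  gcongr
end

section
/- (Proposition 5, CP payoffs.) For every CP k ∈ {1,…,K}, the Shapley value payoff of player k in the (K+1)-player game with characteristic function v equals x_k = (1/2)·v_k − F/(K·(K+1)). -/
/-- Shapley value of player `i` in the `(K+1)`-player game on `N = {1,…,K+1}`:
`x_i = Σ_{S ⊆ N∖{i}} (|S|!·(n−1−|S|)!/n!)·(v(S ∪ {i}) − v(S))` with `n = K+1`. -/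
noncomputable def shapley (K : ℕ) (vk : ℕ → ℝ) (F : ℝ) (i : ℕ) : ℝ :=
  ∑ S ∈ ((Finset.Icc 1 (K + 1)).erase i).powerset,
    (((S.card.factorial * (K - S.card).factorial : ℕ) : ℝ) /
        (((K + 1).factorial : ℕ) : ℝ)) *
      (charv K vk F (insert i S) - charv K vk F S)

open Finset in
/-- Without the ISP, a CP adds nothing to a coalition. -/
lemma charv_insert_sub_of_notMem {K : ℕ} (vk : ℕ → ℝ) (F : ℝ) {k : ℕ} (hk : k ≤ K)
    {T : Finset ℕ} (hT : K + 1 ∉ T) :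
    charv K vk F (insert k T) - charv K vk F T = 0 := by
  have h : K + 1 ∉ insert k T := by
    simp only [mem_insert, not_or]
    exact ⟨by omega, hT⟩
  simp [charv, h, hT]

open Finset in
/-- In the presence of the ISP, a CP adds its contribution, minus the fixed cost if it is the
first CP to join. -/
lemma charv_insert_insert_sub {K : ℕ} (vk : ℕ → ℝ) (F : ℝ) {k : ℕ} (hk : k ≤ K)
    {T : Finset ℕ} (hT : ∀ j ∈ T, j ≤ K) (hkT : k ∉ T) :
    charv K vk F (insert k (insert (K + 1) T)) - charv K vk F (insert (K + 1) T) =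
      vk k - if T = ∅ then F else 0 := by
  have hfilter : (insert (K + 1) T).filter (fun j => j ≤ K) = T := by
    rw [filter_insert, if_neg (by omega), filter_true_of_mem hT]
  have hfilter' : (insert k (insert (K + 1) T)).filter (fun j => j ≤ K) = insert k T := by
    rw [filter_insert, if_pos hk, hfilter]
  have hpos : K + 1 ∈ insert k (insert (K + 1) T) ∧
      ∃ j ∈ insert k (insert (K + 1) T), j ≤ K := ⟨by simp, k, by simp, hk⟩
  rw [charv, if_pos hpos, hfilter', sum_insert hkT, charv, hfilter]
  rcases T.eq_empty_or_nonempty with rfl | hne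
  · simp
  · obtain ⟨j, hj⟩ := hne
    rw [if_pos ⟨by simp, j, by simp [hj], hT j hj⟩, if_neg (ne_empty_of_mem hj)]
    ring

open Finset in
/-- In a random ordering, the ISP precedes a given CP with probability one half. -/
lemma sum_powerset_shapley_weight (s : Finset ℕ) :
    ∑ T ∈ s.powerset, (((#T + 1).factorial * (#s - #T).factorial : ℕ) : ℝ) /
      (((#s + 2).factorial : ℕ) : ℝ) = 1 / 2 := by
  rw [sum_powerset_apply_card (fun j => (((j + 1).factorial * (#s - j).factorial : ℕ) : ℝ) /
    (((#s + 2).factorial : ℕ) : ℝ))]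
  have hterm : ∀ j ∈ range (#s + 1), (#s).choose j •
      ((((j + 1).factorial * (#s - j).factorial : ℕ) : ℝ) / (((#s + 2).factorial : ℕ) : ℝ)) =
      ((j + 1 : ℕ) : ℝ) / (((#s + 2) * (#s + 1) : ℕ) : ℝ) := by
    intro j hj
    have hchoose := Nat.choose_mul_factorial_mul_factorial (Nat.lt_succ_iff.1 (mem_range.1 hj))
    rw [nsmul_eq_mul, ← mul_div_assoc, div_eq_div_iff (by positivity) (by positivity)]
    norm_cast
    rw [Nat.factorial_succ (#s + 1), Nat.factorial_succ #s, Nat.factorial_succ j, ← hchoose]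
    ring
  have hgauss : ∀ n : ℕ, ∑ j ∈ range n, ((j + 1 : ℕ) : ℝ) = n * (n + 1) / 2 := by
    intro n
    induction n with
    | zero => simp
    | succ n ih => rw [sum_range_succ, ih]; push_cast; ring
  rw [sum_congr rfl hterm, ← sum_div, hgauss]
  push_cast
  field_simp
  ring

/-- Proposition 5, CP payoffs: for every CP `k ∈ {1,…,K}`, the
Shapley value payoff of player `k` equals `x_k = (1/2)·v_k − F/(K·(K+1))`. -/
theorem shapley_CP (K : ℕ) (hK : 1 ≤ K) (vk : ℕ → ℝ) (F : ℝ)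
    (k : ℕ) (hk : k ∈ Finset.Icc 1 K) :
    shapley K vk F k = (1 / 2) * vk k - F / ((K : ℝ) * ((K : ℝ) + 1)) := by
  obtain ⟨m, rfl⟩ : ∃ m, K = m + 1 := ⟨K - 1, by omega⟩
  obtain ⟨hk1, hkK⟩ := Finset.mem_Icc.1 hk
  set s := (Finset.Icc 1 (m + 1)).erase k with hs
  have hcard : s.card = m := by simp [hs, Finset.card_erase_of_mem hk]
  have hsK : ∀ T ∈ s.powerset, ∀ j ∈ T, j ≤ m + 1 := fun T hT j hj =>
    (Finset.mem_Icc.1 (Finset.mem_of_mem_erase (Finset.mem_powerset.1 hT hj))).2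
  have hIcc : (Finset.Icc 1 (m + 1 + 1)).erase k = insert (m + 1 + 1) s := by
    ext j
    simp only [hs, Finset.mem_erase, Finset.mem_Icc, Finset.mem_insert]
    omega
  have hlast : m + 1 + 1 ∉ s := by simp [hs]
  have hzero := Finset.sum_eq_zero (s := s.powerset)
    (f := fun T => (((T.card.factorial * (m + 1 - T.card).factorial : ℕ) : ℝ) /
      (((m + 1 + 1).factorial : ℕ) : ℝ)) *
      (charv (m + 1) vk F (insert k T) - charv (m + 1) vk F T)) fun T hT => by
    rw [charv_insert_sub_of_notMem vk F hkK
      (fun h => hlast (Finset.mem_powerset.1 hT h)), mul_zero]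
  have hterm : ∀ T ∈ s.powerset,
      ((((insert (m + 1 + 1) T).card.factorial *
          (m + 1 - (insert (m + 1 + 1) T).card).factorial : ℕ) : ℝ) /
        (((m + 1 + 1).factorial : ℕ) : ℝ)) *
      (charv (m + 1) vk F (insert k (insert (m + 1 + 1) T)) -
        charv (m + 1) vk F (insert (m + 1 + 1) T)) =
      (((T.card + 1).factorial * (s.card - T.card).factorial : ℕ) : ℝ) /
        (((s.card + 2).factorial : ℕ) : ℝ) * vk k -
      if T = ∅ then (m.factorial : ℝ) / ((m + 2).factorial : ℝ) * F else 0 := by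
    intro T hT
    have hTs := Finset.mem_powerset.1 hT
    rw [charv_insert_insert_sub vk F hkK (hsK T hT) (fun h => by simpa [hs] using hTs h),
      Finset.card_insert_of_notMem (fun h => hlast (hTs h)), hcard, Nat.add_sub_add_right]
    split_ifs with hempty
    · subst hempty
      simp [mul_sub]
    · simp
  rw [shapley, hIcc, Finset.sum_powerset_insert hlast, hzero, zero_add,
    Finset.sum_congr rfl hterm, Finset.sum_sub_distrib, ← Finset.sum_mul,
    sum_powerset_shapley_weight, Finset.sum_ite_eq' s.powerset ∅,
    if_pos (Finset.empty_mem_powerset s), Nat.factorial_succ (m + 1), Nat.factorial_succ m]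
  have hm : (m.factorial : ℝ) ≠ 0 := by positivity
  push_cast
  field_simp
end
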